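/- For every graph G, the treewidth of G equals one less than the maximum order of a bramble in G. -/

import Mathlib

open SimpleGraph

variable {V : Type*}

/-- A bramble: a family of vertex sets, each inducing a connected subgraph,
pairwise intersecting or joined by an edge. -/
def IsBramble (G : SimpleGraph V) (B : Set (Set V)) : Prop :=
  (∀ S ∈ B, S.Nonempty ∧ (G.induce S).Connected) ∧
  (∀ S ∈ B, ∀ T ∈ B, (S ∩ T).Nonempty ∨ ∃ u ∈ S, ∃ v ∈ T, G.Adj u v)

/-- `X` hits every element of the family `B`. -/
def HitsAll (B : Set (Set V)) (X : Set V) : Prop := ∀ S ∈ B, (S ∩ X).Nonempty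

/-- The order of a bramble: minimum size of a hitting set. -/
noncomputable def brambleOrder (B : Set (Set V)) : ℕ :=
  sInf {n | ∃ X : Set V, X.Finite ∧ X.ncard = n ∧ HitsAll B X}

/-- The subfamily of elements of `B` meeting `X`. -/
def sub (B : Set (Set V)) (X : Set V) : Set (Set V) := {S ∈ B | (S ∩ X).Nonempty}

/-- `G` has a tree decomposition of width at most `w`. -/
def HasTreeDecompWidth (G : SimpleGraph V) (w : ℕ) : Prop :=
  ∃ (ι : Type) (T : SimpleGraph ι) (bag : ι → Set V),
    T.IsTree ∧
    (∀ v, ∃ i, v ∈ bag i) ∧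
    (∀ u v, G.Adj u v → ∃ i, u ∈ bag i ∧ v ∈ bag i) ∧
    (∀ v, (T.induce {i | v ∈ bag i}).Connected) ∧
    (∀ i, (bag i).Finite ∧ (bag i).ncard ≤ w + 1)

/-- The treewidth of `G`. -/
noncomputable def treewidth (G : SimpleGraph V) : ℕ := sInf {w | HasTreeDecompWidth G w}

section Helpers

universe u1 u2

lemma conn_walk {ι : Type u1} {T : SimpleGraph ι} {S : Set ι} (h : (T.induce S).Connected)
    {x y : ι} (hx : x ∈ S) (hy : y ∈ S) : ∃ p : T.Walk x y, ∀ z ∈ p.support, z ∈ S := by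
  obtain ⟨p⟩ := h.preconnected ⟨x, hx⟩ ⟨y, hy⟩
  suffices H : ∀ a b : S, (T.induce S).Walk a b →
      ∃ p : T.Walk a.1 b.1, ∀ z ∈ p.support, z ∈ S from H _ _ p
  intro a b p
  induction p with
  | nil => exact ⟨Walk.nil, by simp⟩
  | @cons u v w huv p ih =>
    obtain ⟨q, hq⟩ := ih
    refine ⟨Walk.cons (by simpa using huv) q, ?_⟩
    intro z hz
    rw [Walk.support_cons, List.mem_cons] at hz
    rcases hz with rfl | hz
    · exact u.2
    · exact hq z hz

lemma conn_of_walk {ι : Type u1} {T : SimpleGraph ι} {S : Set ι} (u : ι) (hu : u ∈ S)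
    (h : ∀ y ∈ S, ∃ p : T.Walk u y, ∀ z ∈ p.support, z ∈ S) : (T.induce S).Connected := by
  apply induce_connected_of_patches u hu
  intro v hv
  obtain ⟨p, hp⟩ := h v hv
  exact ⟨{z | z ∈ p.support}, hp, p.start_mem_support, p.end_mem_support,
    p.connected_induce_support.preconnected _ _⟩

/-- `m` separates `s` from `t` (or equals one of them). -/
def TBtw {ι : Type u1} (T : SimpleGraph ι) (s m t : ι) : Prop :=
  ∀ p : T.Walk s t, m ∈ p.support

lemma TBtw.split {ι : Type u1} {T : SimpleGraph ι} {s m t : ι} (h : TBtw T s m t) (i : ι) :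
    TBtw T s m i ∨ TBtw T i m t := by
  by_contra hc
  unfold TBtw at hc
  push Not at hc
  obtain ⟨⟨p, hp⟩, q, hq⟩ := hc
  have := h (p.append q)
  rw [Walk.mem_support_append_iff] at this
  tauto

lemma TBtw.mem {ι : Type u1} {T : SimpleGraph ι} {s m t : ι} (h : TBtw T s m t) {S : Set ι}
    (hS : (T.induce S).Connected) (hs : s ∈ S) (ht : t ∈ S) : m ∈ S := by
  obtain ⟨p, hp⟩ := conn_walk hS hs ht
  exact hp _ (h p)

lemma btw_of_path {ι : Type u1} {T : SimpleGraph ι} (hT : T.IsTree) {s m t : ι}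
    {p : T.Walk s t} (hp : p.IsPath) (hm : m ∈ p.support) : TBtw T s m t := by
  classical
  intro q
  have : p = q.bypass :=
    congrArg Subtype.val ((hT.isAcyclic.subsingleton_path _ _).elim
      (⟨p, hp⟩ : T.Path s t) ⟨q.bypass, q.bypass_isPath⟩)
  exact q.support_bypass_subset_support (this ▸ hm)

lemma gate {ι : Type u1} {T : SimpleGraph ι} (hT : T.IsTree) (r : ι) {A : Set ι}
    (hA : (T.induce A).Connected) : ∃ g ∈ A, ∀ y ∈ A, TBtw T r g y := by
  classical
  have hne : A.Nonempty := by
    obtain ⟨x⟩ := hA.nonempty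
    exact ⟨x.1, x.2⟩
  obtain ⟨g, hgA, hg⟩ := WellFounded.has_min (measure (fun i => T.dist r i)).wf A hne
  refine ⟨g, hgA, ?_⟩
  intro y hy
  obtain ⟨p, hp⟩ := hT.connected.exists_walk_length_eq_dist r g
  obtain ⟨q, hq⟩ := conn_walk hA hgA hy
  have hpp := p.isPath_of_length_eq_dist hp
  have hint : ∀ z ∈ p.support, z ∈ A → z = g := by
    intro z hz hzA
    have h1 := hg z hzA
    have h2 : ¬ (T.dist r z < T.dist r g) := h1
    by_contra hne
    have h3 := Walk.length_takeUntil_lt_length hz hne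
    have h4 := dist_le (p.takeUntil z hz)
    omega
  have hpath : (p.append q.bypass).IsPath := by
    rw [Walk.isPath_def, Walk.support_append]
    rw [List.nodup_append']
    refine ⟨hpp.support_nodup, q.bypass_isPath.support_nodup.tail, ?_⟩
    intro z hz hz'
    have hzA : z ∈ A := hq _ (q.support_bypass_subset_support (List.mem_of_mem_tail hz'))
    have := hint z hz hzA
    subst this
    have hn := q.bypass_isPath.support_nodup
    rw [← Walk.cons_tail_support] at hn
    exact (List.nodup_cons.1 hn).1 hz'
  exact btw_of_path hT hpath (by simp)

/-- Helly property for finitely many subtrees. -/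
lemma helly {ι : Type u1} {T : SimpleGraph ι} (hT : T.IsTree) {κ : Type u2} [Finite κ]
    (A : κ → Set ι) (hA : ∀ k, (T.induce (A k)).Connected)
    (hAA : ∀ k l, (A k ∩ A l).Nonempty) : ∃ g, ∀ k, g ∈ A k := by
  classical
  obtain ⟨r⟩ := hT.connected.nonempty
  rcases isEmpty_or_nonempty κ with hκ | hκ
  · exact ⟨r, fun k => hκ.elim k⟩
  choose g hgA hg using fun k => gate hT r (hA k)
  obtain ⟨k, hk⟩ := Finite.exists_max (fun k => T.dist r (g k))
  refine ⟨g k, fun l => ?_⟩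
  obtain ⟨x, hxk, hxl⟩ := hAA k l
  rcases (hg k x hxk).split (g l) with h | h
  · obtain ⟨p, hp⟩ := hT.connected.exists_walk_length_eq_dist r (g l)
    have hz := h p
    by_cases hne : g k = g l
    · rw [hne]; exact hgA l
    · have h3 := Walk.length_takeUntil_lt_length hz hne
      have h4 := dist_le (p.takeUntil _ hz)
      have := hk l
      omega
  · exact h.mem (hA l) (hgA l) hxl

/-- Convex hull of a subtree and a vertex. -/
lemma hull_conn {ι : Type u1} {T : SimpleGraph ι} (hT : T.IsTree) (s : ι) {A : Set ι}
    (hA : (T.induce A).Connected) :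
    (T.induce {t | ∃ t' ∈ A, TBtw T s t t'}).Connected := by
  classical
  obtain ⟨⟨a, ha⟩⟩ := hA.nonempty
  refine conn_of_walk s ⟨a, ha, fun p => p.start_mem_support⟩ ?_
  rintro y ⟨t', ht', hy⟩
  obtain ⟨p, hp⟩ := hT.existsUnique_path s t' |>.exists
  refine ⟨p.takeUntil y (hy p), fun z hz => ⟨t', ht', ?_⟩⟩
  exact btw_of_path hT hp (p.support_takeUntil_subset_support _ hz)

lemma sum_acyclic {ι : Type u1} {κ : Type u2} {T : SimpleGraph ι} {S : SimpleGraph κ}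
    (hT : T.IsAcyclic) (hS : S.IsAcyclic) : (T ⊕g S).IsAcyclic := by
  rw [isAcyclic_iff_forall_adj_isBridge] at *
  rintro (a | a) (b | b) hab
  · have h := hT (by simpa using hab : T.Adj a b)
    rw [isBridge_iff] at h ⊢
    intro hr
    apply h
    obtain ⟨p⟩ := hr
    suffices H : ∀ x y, ((T ⊕g S).deleteEdges {s(Sum.inl a, Sum.inl b)}).Walk x y →
        ∀ i, x = Sum.inl i → ∃ j, y = Sum.inl j ∧ (T.deleteEdges {s(a, b)}).Reachable i j by
      obtain ⟨j, hj, h⟩ := H _ _ p a rfl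
      cases hj
      exact h
    intro x y p
    induction p with
    | nil => exact fun i hi => ⟨i, hi, Reachable.refl _⟩
    | @cons u v w huv p ih =>
      rintro i rfl
      rcases v with v | v
      · obtain ⟨j, hj, h⟩ := ih v rfl
        refine ⟨j, hj, Reachable.trans (Adj.reachable ?_) h⟩
        simpa [deleteEdges_adj] using huv
      · simp [deleteEdges_adj] at huv
  · simp at hab
  · simp at hab
  · have h := hS (by simpa using hab : S.Adj a b)
    rw [isBridge_iff] at h ⊢
    intro hr
    apply h
    obtain ⟨p⟩ := hr
    suffices H : ∀ x y, ((T ⊕g S).deleteEdges {s(Sum.inr a, Sum.inr b)}).Walk x y →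
        ∀ i, x = Sum.inr i → ∃ j, y = Sum.inr j ∧ (S.deleteEdges {s(a, b)}).Reachable i j by
      obtain ⟨j, hj, h⟩ := H _ _ p a rfl
      cases hj
      exact h
    intro x y p
    induction p with
    | nil => exact fun i hi => ⟨i, hi, Reachable.refl _⟩
    | @cons u v w huv p ih =>
      rintro i rfl
      rcases v with v | v
      · simp [deleteEdges_adj] at huv
      · obtain ⟨j, hj, h⟩ := ih v rfl
        refine ⟨j, hj, Reachable.trans (Adj.reachable ?_) h⟩
        simpa [deleteEdges_adj] using huv

lemma join_tree {ι : Type u1} {κ : Type u2} {T : SimpleGraph ι} {S : SimpleGraph κ}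
    (hT : T.IsTree) (hS : S.IsTree) (a : ι) (b : κ) :
    ((T ⊕g S) ⊔ edge (Sum.inl a) (Sum.inr b)).IsTree :=
  ⟨hT.connected.sum_sup_edge hS.connected,
    (sum_acyclic hT.isAcyclic hS.isAcyclic).sup_edge_of_not_reachable
      (not_reachable_sum_inl_inr a b)⟩

/-- Tree decomposition of the subgraph of `G` induced on `H`. -/
structure TreeDec {V : Type u1} (G : SimpleGraph V) (H : Set V) {ι : Type u2}
    (T : SimpleGraph ι) (bag : ι → Set V) : Prop where
  tree : T.IsTree
  sub : ∀ i, bag i ⊆ H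
  conn : ∀ v ∈ H, (T.induce {i | v ∈ bag i}).Connected
  edge : ∀ u ∈ H, ∀ v ∈ H, G.Adj u v → ∃ i, u ∈ bag i ∧ v ∈ bag i

lemma TreeDec.cover {V : Type u1} {G : SimpleGraph V} {H : Set V} {ι : Type u2}
    {T : SimpleGraph ι} {bag : ι → Set V} (h : TreeDec G H T bag) {v : V} (hv : v ∈ H) :
    ∃ i, v ∈ bag i := by
  obtain ⟨i⟩ := (h.conn v hv).nonempty
  exact ⟨i.1, i.2⟩

lemma TreeDec.walk_meets {V : Type u1} {G : SimpleGraph V} {ι : Type u2}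
    {T : SimpleGraph ι} {bag : ι → Set V} (h : TreeDec G Set.univ T bag) {a b : V}
    (p : G.Walk a b) : ∀ {s t t' : ι}, a ∈ bag s → b ∈ bag t' → TBtw T s t t' →
    ∃ m ∈ p.support, m ∈ bag t := by
  induction p with
  | @nil u =>
    intro s t t' ha hb hB
    exact ⟨u, by simp, hB.mem (h.conn u trivial) ha hb⟩
  | @cons u v w huv p ih =>
    intro s t t' ha hb hB
    obtain ⟨i, hui, hvi⟩ := h.edge u trivial v trivial huv
    rcases hB.split i with h1 | h1
    · exact ⟨u, by simp, h1.mem (h.conn u trivial) ha hui⟩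
    · obtain ⟨m, hm, hmt⟩ := ih hvi hb h1
      exact ⟨m, by simp [hm], hmt⟩

lemma TreeDec.exists_hit {V : Type u1} [Finite V] {G : SimpleGraph V} {ι : Type u2}
    {T : SimpleGraph ι} {bag : ι → Set V} (h : TreeDec G Set.univ T bag) {B : Set (Set V)}
    (hB : IsBramble G B) : ∃ i, HitsAll B (bag i) := by
  obtain ⟨g, hg⟩ := helly h.tree (κ := B) (fun S => {i | (S.1 ∩ bag i).Nonempty}) (by
      rintro ⟨S, hS⟩
      obtain ⟨⟨a, ha⟩, hc⟩ := hB.1 S hS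
      obtain ⟨u, hu⟩ := h.cover (Set.mem_univ a)
      refine conn_of_walk u ⟨a, ha, hu⟩ ?_
      rintro y ⟨b, hb, hby⟩
      obtain ⟨q, hq⟩ := h.tree.existsUnique_path u y |>.exists
      refine ⟨q, fun z hz => ?_⟩
      obtain ⟨p, hp⟩ := conn_walk hc ha hb
      obtain ⟨m, hm, hmz⟩ := h.walk_meets p hu hby (btw_of_path h.tree hq hz)
      exact ⟨m, hp m hm, hmz⟩) (by
      rintro ⟨S, hS⟩ ⟨S', hS'⟩
      rcases hB.2 S hS S' hS' with ⟨x, hx, hx'⟩ | ⟨x, hx, y, hy, hxy⟩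
      · obtain ⟨i, hi⟩ := h.cover (Set.mem_univ x)
        exact ⟨i, ⟨x, hx, hi⟩, ⟨x, hx', hi⟩⟩
      · obtain ⟨i, hi, hi'⟩ := h.edge x trivial y trivial hxy
        exact ⟨i, ⟨x, hx, hi⟩, ⟨y, hy, hi'⟩⟩)
  exact ⟨g, fun S hS => hg ⟨S, hS⟩⟩

/-- `G[H]` has a tree decomposition with `X` as a part, all parts satisfying `Q`. -/
def HasTD {V : Type u1} (G : SimpleGraph V) (H X : Set V) (Q : Set V → Prop) : Prop :=
  ∃ (ι : Type) (T : SimpleGraph ι) (bag : ι → Set V) (s : ι),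
    TreeDec G H T bag ∧ bag s = X ∧ ∀ i, Q (bag i)

lemma hasTD_single {V : Type u1} (G : SimpleGraph V) (X : Set V) (Q : Set V → Prop)
    (hQ : Q X) : HasTD G X X Q := by
  refine ⟨Unit, ⊥, fun _ => X, (), ⟨IsTree.of_subsingleton, fun _ => subset_rfl, ?_, ?_⟩,
    rfl, fun _ => hQ⟩
  · intro v hv
    refine conn_of_walk () hv (fun y _ => ⟨Walk.nil, ?_⟩)
    intro z _
    exact hv
  · exact fun u hu v hv _ => ⟨(), hu, hv⟩

/-- Joining two tree decompositions by a tree edge. -/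
lemma hasTD_join {V : Type u1} {G : SimpleGraph V} {H₁ H₂ X X₂ : Set V} {Q : Set V → Prop}
    (h₁ : HasTD G H₁ X Q) (h₂ : HasTD G H₂ X₂ Q) (hX : H₁ ∩ H₂ ⊆ X ∩ X₂)
    (hE : ∀ u ∈ H₁, ∀ v ∈ H₂, G.Adj u v → u ∈ H₂ ∨ v ∈ H₁) : HasTD G (H₁ ∪ H₂) X Q := by
  obtain ⟨ι, T, bag, s, hT, hs, hQ⟩ := h₁
  obtain ⟨κ, S, bag', s', hS, hs', hQ'⟩ := h₂
  have hl : ∀ {a b : ι} (p : T.Walk a b), ∃ q : ((T ⊕g S) ⊔ edge (Sum.inl s) (Sum.inr s')).Walk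
      (Sum.inl a) (Sum.inl b), ∀ z ∈ q.support, ∃ w ∈ p.support, z = Sum.inl w := by
    intro a b p
    induction p with
    | nil => exact ⟨Walk.nil, by simp⟩
    | @cons u v w huv p ih =>
      obtain ⟨q, hq⟩ := ih
      refine ⟨Walk.cons (by simp [huv]) q, ?_⟩
      intro z hz
      rw [Walk.support_cons, List.mem_cons] at hz
      rcases hz with rfl | hz
      · exact ⟨u, by simp⟩
      · obtain ⟨w, hw, rfl⟩ := hq z hz
        exact ⟨w, by simp [hw]⟩
  have hr : ∀ {a b : κ} (p : S.Walk a b), ∃ q : ((T ⊕g S) ⊔ edge (Sum.inl s) (Sum.inr s')).Walk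
      (Sum.inr a) (Sum.inr b), ∀ z ∈ q.support, ∃ w ∈ p.support, z = Sum.inr w := by
    intro a b p
    induction p with
    | nil => exact ⟨Walk.nil, by simp⟩
    | @cons u v w huv p ih =>
      obtain ⟨q, hq⟩ := ih
      refine ⟨Walk.cons (by simp [huv]) q, ?_⟩
      intro z hz
      rw [Walk.support_cons, List.mem_cons] at hz
      rcases hz with rfl | hz
      · exact ⟨u, by simp⟩
      · obtain ⟨w, hw, rfl⟩ := hq z hz
        exact ⟨w, by simp [hw]⟩
  have hadj : ((T ⊕g S) ⊔ edge (Sum.inl s) (Sum.inr s')).Adj (Sum.inl s) (Sum.inr s') := by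
    simp [edge_adj]
  refine ⟨ι ⊕ κ, (T ⊕g S) ⊔ edge (Sum.inl s) (Sum.inr s'), Sum.elim bag bag', Sum.inl s,
    ⟨join_tree hT.tree hS.tree s s', ?_, ?_, ?_⟩, hs, ?_⟩
  · rintro (i | i)
    · exact (hT.sub i).trans Set.subset_union_left
    · exact (hS.sub i).trans Set.subset_union_right
  · intro v hv
    by_cases h1 : v ∈ H₁
    · have hL : ∀ {i j}, v ∈ bag i → v ∈ bag j →
          ∃ q : ((T ⊕g S) ⊔ edge (Sum.inl s) (Sum.inr s')).Walk (Sum.inl i) (Sum.inl j),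
          ∀ z ∈ q.support, v ∈ Sum.elim bag bag' z := by
        intro i j hi hj
        obtain ⟨p, hp⟩ := conn_walk (hT.conn v h1) (x := i) (y := j) hi hj
        obtain ⟨q, hq⟩ := hl p
        refine ⟨q, fun z hz => ?_⟩
        obtain ⟨w, hw, rfl⟩ := hq z hz
        exact hp w hw
      obtain ⟨i, hi⟩ := hT.cover h1
      refine conn_of_walk (Sum.inl i) hi ?_
      rintro (j | j) hj
      · exact hL hi hj
      · have h2 : v ∈ H₂ := hS.sub j hj
        obtain ⟨hvX, hvX2⟩ := hX ⟨h1, h2⟩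
        rw [← hs] at hvX
        rw [← hs'] at hvX2
        obtain ⟨q, hq⟩ := hL hi hvX
        obtain ⟨p, hp⟩ := conn_walk (hS.conn v h2) (x := s') (y := j) hvX2 hj
        obtain ⟨q', hq'⟩ := hr p
        refine ⟨q.append (Walk.cons hadj q'), fun z hz => ?_⟩
        rw [Walk.mem_support_append_iff, Walk.support_cons, List.mem_cons] at hz
        rcases hz with hz | rfl | hz
        · exact hq z hz
        · exact hvX
        · obtain ⟨w, hw, rfl⟩ := hq' z hz
          exact hp w hw
    · have h2 : v ∈ H₂ := hv.resolve_left h1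
      obtain ⟨i, hi⟩ := hS.cover h2
      refine conn_of_walk (Sum.inr i) hi ?_
      rintro (j | j) hj
      · exact absurd (hT.sub j hj) h1
      · obtain ⟨p, hp⟩ := conn_walk (hS.conn v h2) (x := i) (y := j) hi hj
        obtain ⟨q, hq⟩ := hr p
        refine ⟨q, fun z hz => ?_⟩
        obtain ⟨w, hw, rfl⟩ := hq z hz
        exact hp w hw
  · have key1 : ∀ u ∈ H₁, ∀ v ∈ H₁, G.Adj u v →
        ∃ i : ι ⊕ κ, u ∈ Sum.elim bag bag' i ∧ v ∈ Sum.elim bag bag' i := by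
      intro u hu v hv huv
      obtain ⟨i, hi⟩ := hT.edge u hu v hv huv
      exact ⟨Sum.inl i, hi⟩
    have key2 : ∀ u ∈ H₂, ∀ v ∈ H₂, G.Adj u v →
        ∃ i : ι ⊕ κ, u ∈ Sum.elim bag bag' i ∧ v ∈ Sum.elim bag bag' i := by
      intro u hu v hv huv
      obtain ⟨i, hi⟩ := hS.edge u hu v hv huv
      exact ⟨Sum.inr i, hi⟩
    intro u hu v hv huv
    rcases hu with hu | hu <;> rcases hv with hv | hv
    · exact key1 u hu v hv huv
    · rcases hE u hu v hv huv with h | h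
      · exact key2 u h v hv huv
      · exact key1 u hu v h huv
    · rcases hE v hv u hu huv.symm with h | h
      · exact key2 u hu v h huv
      · exact key1 u h v hv huv
    · exact key2 u hu v hv huv
  · rintro (i | i)
    · exact hQ i
    · exact hQ' i

/-- A part is admissible if it is small or fails to cover the bramble. -/
def AdmBag {V : Type u1} (B : Set (Set V)) (k : ℕ) (S : Set V) : Prop :=
  k < S.ncard → ¬ HitsAll B S

/-- Cut a walk ending in `X` at its first vertex in `X`. -/
lemma first_hit {V : Type u1} {G : SimpleGraph V} {X C : Set V}
    (hCN : ∀ c ∈ C, ∀ w, G.Adj c w → w ∈ C ∪ X) {a b : V} (p : G.Walk a b) :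
    a ∉ X ∪ C → b ∈ X → ∃ w ∈ X, ∃ q : G.Walk a w, (∀ z ∈ q.support, z ∈ p.support) ∧
      ∀ z ∈ q.support, z = w ∨ z ∉ X ∪ C := by
  induction p with
  | nil => exact fun ha hb => absurd (Or.inl hb) ha
  | @cons u v w huv p ih =>
    intro ha hb
    by_cases hv : v ∈ X
    · refine ⟨v, hv, Walk.cons huv Walk.nil, ?_, ?_⟩
      · intro z hz
        simp only [Walk.support_cons, Walk.support_nil, List.mem_cons, List.not_mem_nil,
          or_false] at hz
        rcases hz with rfl | rfl <;> simp
      · intro z hz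
        simp only [Walk.support_cons, Walk.support_nil, List.mem_cons, List.not_mem_nil,
          or_false] at hz
        rcases hz with rfl | rfl
        · exact Or.inr ha
        · exact Or.inl rfl
    · have hvC : v ∉ C := fun h => ha (Or.symm (hCN v h u huv.symm))
      obtain ⟨x, hx, q, hq, hq'⟩ := ih (by rintro (h | h) <;> contradiction) hb
      refine ⟨x, hx, Walk.cons huv q, ?_, ?_⟩
      · intro z hz
        rw [Walk.support_cons, List.mem_cons] at hz ⊢
        exact hz.imp_right (hq z)
      · intro z hz
        rw [Walk.support_cons, List.mem_cons] at hz
        rcases hz with rfl | hz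
        · exact Or.inr ha
        · exact hq' z hz

lemma comp_td {V : Type u1} [Finite V] {G : SimpleGraph V} {B : Set (Set V)} {k : ℕ} {X C : Set V}
    (hB : IsBramble G B) (hX : HitsAll B X) (hmin : ∀ Y, HitsAll B Y → X.ncard ≤ Y.ncard)
    (hk : X.ncard ≤ k) (hCne : C.Nonempty) (hC : (G.induce C).Connected) (hCX : ∀ c ∈ C, c ∉ X)
    (hCN : ∀ c ∈ C, ∀ w, G.Adj c w → w ∈ C ∪ X)
    (IH : IsBramble G (insert C B) → ∃ X', HasTD G Set.univ X' (AdmBag (insert C B) k))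
    (hno : ¬ ∃ X', HasTD G Set.univ X' (AdmBag B k)) : HasTD G (X ∪ C) X (AdmBag B k) := by
  have hQX : AdmBag B k X := fun h => absurd hk (by omega)
  by_cases hB' : IsBramble G (insert C B)
  swap
  · -- some `U ∈ B` does not touch `C`
    have : ∃ U ∈ B, ¬ (C ∩ U).Nonempty ∧ ¬ ∃ u ∈ C, ∃ v ∈ U, G.Adj u v := by
      by_contra hc
      push Not at hc
      apply hB'
      have hc' : ∀ U ∈ B, (C ∩ U).Nonempty ∨ ∃ u ∈ C, ∃ v ∈ U, G.Adj u v := by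
        intro U hU
        by_cases h : (C ∩ U).Nonempty
        · exact Or.inl h
        · exact Or.inr (hc U hU (Set.not_nonempty_iff_eq_empty.1 h))
      refine ⟨?_, ?_⟩
      · rintro S (rfl | hS)
        · exact ⟨hCne, hC⟩
        · exact hB.1 S hS
      · rintro S (rfl | hS) S' (rfl | hS')
        · left; simpa using hCne
        · exact hc' S' hS'
        · rcases hc' S hS with h | ⟨u, hu, v, hv, huv⟩
          · left; rwa [Set.inter_comm]
          · exact Or.inr ⟨v, hv, u, hu, huv.symm⟩
        · exact hB.2 S hS S' hS'
    obtain ⟨U, hU, h1, h2⟩ := this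
    have hQY : AdmBag B k (C ∪ {x ∈ X | ∃ c ∈ C, G.Adj c x}) := by
      intro _ hh
      obtain ⟨x, hxU, hx | ⟨_, c, hc, hcx⟩⟩ := hh U hU
      · exact h1 ⟨x, hx, hxU⟩
      · exact h2 ⟨c, hc, x, hxU, hcx⟩
    have := hasTD_join (hasTD_single G X _ hQX) (hasTD_single G _ _ hQY) subset_rfl (by
      rintro u hu v (hv | ⟨hv, _⟩) huv
      · exact Or.inl (Or.inr ⟨hu, v, hv, huv.symm⟩)
      · exact Or.inr hv)
    convert this using 1
    ext x
    simp only [Set.mem_union, Set.mem_ofPred_eq]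
    tauto
  obtain ⟨_, ι, T, bag, _, hT, _, hQ⟩ := IH hB'
  have : ∃ s, k < (bag s).ncard ∧ HitsAll B (bag s) := by
    by_contra hc
    push Not at hc
    obtain ⟨i⟩ := hT.tree.connected.nonempty
    exact hno ⟨_, ι, T, bag, i, hT, rfl, hc⟩
  obtain ⟨s, hsk, hsB⟩ := this
  have hsC : ∀ c ∈ C, c ∉ bag s := by
    intro c hc hcs
    apply hQ s hsk
    rintro S (rfl | hS)
    · exact ⟨c, hc, hcs⟩
    · exact hsB S hS
  -- the new bags
  let Z : ι → Set V := fun t => {x | x ∈ X ∧ ∃ t', x ∈ bag t' ∧ TBtw T s t t'}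
  let W : ι → Set V := fun t => (bag t ∩ (X ∪ C)) ∪ Z t
  have hTB : ∀ t, TBtw T s t t := fun t p => p.end_mem_support
  have hWX : ∀ t x, x ∈ X → (x ∈ W t ↔ ∃ t' ∈ {i | x ∈ bag i}, TBtw T s t t') := by
    intro t x hx
    constructor
    · rintro (⟨h, _⟩ | ⟨_, h⟩)
      · exact ⟨t, h, hTB t⟩
      · exact h
    · exact fun h => Or.inr ⟨hx, h⟩
  have hWC : ∀ t x, x ∈ C → (x ∈ W t ↔ x ∈ bag t) := by
    intro t x hx
    constructor
    · rintro (⟨h, _⟩ | ⟨h, _⟩)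
      · exact h
      · exact absurd h (hCX x hx)
    · exact fun h => Or.inl ⟨h, Or.inr hx⟩
  -- a member of `B` meeting `Z t \ bag t` ...
  have hcov : ∀ t, HitsAll B ((bag t \ (X ∪ C)) ∪ (X \ (Z t \ bag t))) := by
    intro t U hU
    by_contra hne
    have hne' : ∀ u ∈ U, ¬ (u ∈ (bag t \ (X ∪ C)) ∪ (X \ (Z t \ bag t))) :=
      fun u hu h => hne ⟨u, hu, h⟩
    have hUZ : ∀ u ∈ U, u ∈ X → u ∈ Z t ∧ u ∉ bag t := by
      intro u hu hx
      by_contra hc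
      exact hne' u hu (Or.inr ⟨hx, hc⟩)
    obtain ⟨a, haU, has⟩ := hsB U hU
    obtain ⟨b, hbU, hbX⟩ := hX U hU
    have haX : a ∉ X ∪ C := by
      rintro (h | h)
      · obtain ⟨⟨_, t', ht', hb⟩, hn⟩ := hUZ a haU h
        exact hn (hb.mem (hT.conn a trivial) has ht')
      · exact hsC a h has
    obtain ⟨p, hp⟩ := conn_walk (hB.1 U hU).2 haU hbU
    obtain ⟨w, hwX, q, hq, hq'⟩ := first_hit hCN p haX hbX
    obtain ⟨⟨_, t', ht', hb⟩, hn⟩ := hUZ w (hp w (hq w q.end_mem_support)) hwX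
    obtain ⟨m, hm, hmt⟩ := hT.walk_meets q has ht' hb
    rcases hq' m hm with rfl | hmX
    · exact hn hmt
    · exact hne' m (hp m (hq m hm)) (Or.inl ⟨hmt, hmX⟩)
  have hcard : ∀ t, (W t).ncard ≤ (bag t).ncard := by
    intro t
    have h1 := hmin _ (hcov t)
    have h2 := Set.ncard_union_le (bag t \ (X ∪ C)) (X \ (Z t \ bag t))
    have h3 : (X \ (Z t \ bag t)).ncard + (Z t \ bag t).ncard = X.ncard :=
      Set.ncard_sdiff_add_ncard_of_subset (fun x hx => hx.1.1)
    have h4 : W t ⊆ (bag t ∩ (X ∪ C)) ∪ (Z t \ bag t) := by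
      rintro x (hx | hx)
      · exact Or.inl hx
      · by_cases h : x ∈ bag t
        · exact Or.inl ⟨h, Or.inl hx.1⟩
        · exact Or.inr ⟨hx, h⟩
    have h5 := Set.ncard_le_ncard h4
    have h6 := Set.ncard_union_le (bag t ∩ (X ∪ C)) (Z t \ bag t)
    have h7 := Set.ncard_inter_add_ncard_sdiff_eq_ncard (bag t) (X ∪ C)
    omega
  refine ⟨ι, T, W, s, ⟨hT.tree, ?_, ?_, ?_⟩, ?_, ?_⟩
  · rintro t x (hx | hx)
    · exact hx.2
    · exact Or.inl hx.1
  · rintro v (hv | hv)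
    · have := hull_conn hT.tree s (hT.conn v trivial)
      have he : {i | v ∈ W i} = {t | ∃ t' ∈ {i | v ∈ bag i}, TBtw T s t t'} := by
        ext t; exact hWX t v hv
      rw [he]; exact this
    · have he : {i | v ∈ W i} = {i | v ∈ bag i} := by
        ext t; exact hWC t v hv
      rw [he]; exact hT.conn v trivial
  · intro u hu v hv huv
    obtain ⟨i, h1, h2⟩ := hT.edge u trivial v trivial huv
    exact ⟨i, Or.inl ⟨h1, hu⟩, Or.inl ⟨h2, hv⟩⟩
  · ext x
    constructor
    · rintro (⟨h1, h2 | h2⟩ | h)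
      · exact h2
      · exact absurd h1 (hsC x h2)
      · exact h.1
    · intro hx
      obtain ⟨i, hi⟩ := hT.cover (Set.mem_univ x)
      exact Or.inr ⟨hx, i, hi, fun p => p.start_mem_support⟩
  · intro t htk hhit
    have hbk : k < (bag t).ncard := lt_of_lt_of_le htk (hcard t)
    have hmeet : ∃ c ∈ C, c ∈ bag t := by
      by_contra hc
      push Not at hc
      have : W t ⊆ X := by
        rintro x (⟨h1, h2 | h2⟩ | h)
        · exact h2
        · exact absurd h1 (hc x h2)
        · exact h.1
      have := Set.ncard_le_ncard this
      omega
    obtain ⟨c, hcC, hct⟩ := hmeet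
    apply hQ t hbk
    rintro U (rfl | hU)
    · exact ⟨c, hcC, hct⟩
    · obtain ⟨x, hxU, ⟨hx, _⟩ | ⟨_, t', ht', hb⟩⟩ := hhit U hU
      · exact ⟨x, hxU, hx⟩
      · obtain ⟨a, haU, has⟩ := hsB U hU
        obtain ⟨p, hp⟩ := conn_walk (hB.1 U hU).2 haU hxU
        obtain ⟨m, hm, hmt⟩ := hT.walk_meets p has ht' hb
        exact ⟨m, hp m hm, hmt⟩

/-- Existence of components inside a set closed under adjacency outside `X`. -/
lemma exists_comp {V : Type u1} [Finite V] {G : SimpleGraph V} {X D : Set V} {v : V}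
    (hv : v ∈ D) (hDN : ∀ d ∈ D, ∀ w, G.Adj d w → w ∈ D ∪ X) :
    ∃ C ⊆ D, v ∈ C ∧ (G.induce C).Connected ∧ ∀ c ∈ C, ∀ w, G.Adj c w → w ∈ C ∪ X := by
  refine ⟨{w | ∃ p : G.Walk v w, ∀ z ∈ p.support, z ∈ D}, ?_, ?_, ?_, ?_⟩
  · rintro w ⟨p, hp⟩
    exact hp w p.end_mem_support
  · exact ⟨Walk.nil, by simpa using hv⟩
  · classical
    refine conn_of_walk v ⟨Walk.nil, by simpa using hv⟩ ?_
    rintro y ⟨p, hp⟩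
    refine ⟨p, fun z hz => ⟨p.takeUntil z hz, fun w hw => ?_⟩⟩
    exact hp w (p.support_takeUntil_subset_support _ hw)
  · rintro c ⟨p, hp⟩ w hcw
    rcases hDN c (hp c p.end_mem_support) w hcw with h | h
    · refine Or.inl ⟨p.concat hcw, fun z hz => ?_⟩
      rw [Walk.support_concat, List.mem_append] at hz
      rcases hz with hz | hz
      · exact hp z hz
      · simp at hz; rwa [hz]
    · exact Or.inr h

lemma main_td {V : Type u1} [Finite V] {G : SimpleGraph V} {k : ℕ}
    (hk : ∀ B, IsBramble G B → brambleOrder B ≤ k) (B : Set (Set V)) :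
    IsBramble G B → ∃ X, HasTD G Set.univ X (AdmBag B k) := by
  induction B using (wellFounded_gt (α := Set (Set V))).induction with
  | _ B IH =>
  intro hB
  by_contra hno
  have hne : {n | ∃ X : Set V, X.Finite ∧ X.ncard = n ∧ HitsAll B X}.Nonempty :=
    ⟨_, Set.univ, Set.toFinite _, rfl, fun S hS => by simpa using (hB.1 S hS).1⟩
  obtain ⟨X, _, hXn, hX⟩ := Nat.sInf_mem hne
  have hXk : X.ncard ≤ k := by rw [hXn]; exact hk B hB
  have hmin : ∀ Y, HitsAll B Y → X.ncard ≤ Y.ncard := by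
    intro Y hY
    rw [hXn]
    exact Nat.sInf_le ⟨Y, Set.toFinite _, rfl, hY⟩
  have key : ∀ (n : ℕ) (D : Set V), D.ncard = n → (∀ d ∈ D, d ∉ X) →
      (∀ d ∈ D, ∀ w, G.Adj d w → w ∈ D ∪ X) → HasTD G (X ∪ D) X (AdmBag B k) := by
    intro n
    induction n using Nat.strong_induction_on with
    | _ n ihn =>
    intro D hDn hDX hDN
    rcases D.eq_empty_or_nonempty with rfl | ⟨v, hv⟩
    · rw [Set.union_empty]
      exact hasTD_single G X _ (fun h => absurd hXk (by omega))
    · obtain ⟨C, hCD, hvC, hC, hCN⟩ := exists_comp hv hDN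
      have hCX : ∀ c ∈ C, c ∉ X := fun c hc => hDX c (hCD hc)
      have h1 : HasTD G (X ∪ C) X (AdmBag B k) := by
        refine comp_td hB hX hmin hXk ⟨v, hvC⟩ hC hCX hCN (IH _ ?_) hno
        refine Set.ssubset_insert ?_
        intro hCB
        obtain ⟨x, hx, hx'⟩ := hX C hCB
        exact hCX x hx hx'
      have h2 : HasTD G (X ∪ (D \ C)) X (AdmBag B k) := by
        refine ihn _ ?_ (D \ C) rfl (fun d hd => hDX d hd.1) ?_
        · rw [← hDn]
          exact Set.ncard_lt_ncard ⟨Set.sdiff_subset, fun h => (h hv).2 hvC⟩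
        · rintro d ⟨hd, hdC⟩ w hdw
          rcases hDN d hd w hdw with h | h
          · refine Or.inl ⟨h, fun hwC => ?_⟩
            rcases hCN w hwC d hdw.symm with h' | h'
            · exact hdC h'
            · exact hDX d hd h'
          · exact Or.inr h
      have h3 := hasTD_join h1 h2 (by
          rintro x ⟨hx | hx, hy | hy⟩
          · exact ⟨hx, hx⟩
          · exact ⟨hx, hx⟩
          · exact ⟨hy, hy⟩
          · exact absurd hx hy.2) (by
          rintro u (hu | hu) w hw huw
          · exact Or.inl (Or.inl hu)
          · exact Or.inr (Or.symm (hCN u hu w huw)))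
      convert h3 using 1
      ext x
      have := @hCD x
      simp only [Set.mem_union, Set.mem_sdiff]
      tauto
  have := key _ Xᶜ rfl (fun d hd => hd) (fun d _ w _ => by
    simp only [Set.mem_union, Set.mem_compl_iff]; tauto)
  rw [Set.union_compl_self] at this
  exact hno ⟨X, this⟩

end Helpers

/-- Seymour–Thomas duality: the treewidth of a graph is exactly one less than the
maximum order of a bramble in it. -/
theorem stmt_11 [Fintype V] [Nonempty V] (G : SimpleGraph V) :
    treewidth G + 1 = sSup {n | ∃ B : Set (Set V), IsBramble G B ∧ brambleOrder B = n} := by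
  set O := {n | ∃ B : Set (Set V), IsBramble G B ∧ brambleOrder B = n} with hO
  have hbdd : BddAbove O := by
    refine ⟨(Set.univ : Set V).ncard, ?_⟩
    rintro n ⟨B, hB, rfl⟩
    exact Nat.sInf_le ⟨Set.univ, Set.toFinite _, rfl, fun S hS => by simpa using (hB.1 S hS).1⟩
  have hK : ∀ B, IsBramble G B → brambleOrder B ≤ sSup O :=
    fun B hB => le_csSup hbdd ⟨B, hB, rfl⟩
  have hpos : 1 ≤ sSup O := by
    obtain ⟨v⟩ := ‹Nonempty V›
    have hB : IsBramble G {{v}} := by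
      refine ⟨?_, ?_⟩
      · rintro S rfl
        refine ⟨⟨v, rfl⟩, conn_of_walk v rfl ?_⟩
        rintro y rfl
        exact ⟨Walk.nil, by simp⟩
      · rintro S rfl S' rfl
        left; simp
    refine le_trans ?_ (hK _ hB)
    refine le_csInf ⟨_, Set.univ, Set.toFinite _, rfl, fun S hS => by simpa using (hB.1 S hS).1⟩ ?_
    rintro n ⟨X, hX, rfl, hh⟩
    obtain ⟨x, _, hx⟩ := hh {v} rfl
    exact (Set.ncard_pos hX).2 ⟨x, hx⟩
  have hub : HasTreeDecompWidth G (sSup O - 1) := by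
    obtain ⟨X, ι, T, bag, s, hT, _, hQ⟩ := main_td hK ∅ ⟨by simp, by simp⟩
    refine ⟨ι, T, bag, hT.tree, fun v => hT.cover (Set.mem_univ v),
      fun u v => hT.edge u trivial v trivial, fun v => hT.conn v trivial, fun i =>
      ⟨Set.toFinite _, ?_⟩⟩
    by_contra hc
    exact hQ i (by omega) (fun S hS => absurd hS (Set.notMem_empty S))
  have h1 : treewidth G ≤ sSup O - 1 := Nat.sInf_le hub
  have h2 : sSup O ≤ treewidth G + 1 := by
    obtain ⟨ι, T, bag, hT, hc, he, hconn, hw⟩ :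
      HasTreeDecompWidth G (treewidth G) :=
      Nat.sInf_mem (s := {w | HasTreeDecompWidth G w}) ⟨_, hub⟩
    have hTD : TreeDec G Set.univ T bag :=
      ⟨hT, fun i => Set.subset_univ _, fun v _ => hconn v, fun u _ v _ => he u v⟩
    refine csSup_le' ?_
    rintro n ⟨B, hB, rfl⟩
    obtain ⟨i, hi⟩ := hTD.exists_hit hB
    exact le_trans (Nat.sInf_le ⟨bag i, (hw i).1, rfl, hi⟩) (hw i).2
  omega
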